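/- Let Ω be a body in ℝ^m, and let w ∈ S^{m−1} be a unit vector such that l(w) ≤ 0 and the centroid of Ω lies in the hyperplane w^⊥, i.e., ∫_Ω (y·w) dy = 0. Then Ω is symmetric in the hyperplane w^⊥, that is, Ω = Ω⁺_{w,0} ∪ Refl_{w,0}(Ω⁺_{w,0}) (equivalently Refl_{w,0}(Ω) = Ω), and Ω is convex in the direction w. -/

import Mathlib

open Set MeasureTheory Filter Asymptotics Metric
open scoped Topology RealInnerProductSpace

noncomputable section

/-- `m`-dimensional Euclidean space. -/
abbrev Euc (m : ℕ) := EuclideanSpace ℝ (Fin m)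

/-- A body: the closure of a nonempty bounded open set. -/
def IsBody {m : ℕ} (Ω : Set (Euc m)) : Prop :=
  ∃ U : Set (Euc m), IsOpen U ∧ U.Nonempty ∧ Bornology.IsBounded U ∧ Ω = closure U

/-- The potential `K_Ω(x) = ∫_Ω k(|x - y|) dy`. -/
def pot {m : ℕ} (k : ℝ → ℝ) (Ω : Set (Euc m)) (x : Euc m) : ℝ :=
  ∫ y in Ω, k (dist x y)

/-- Condition `(C⁰_α)`. -/
def CondC0 (m : ℕ) (α : ℝ) (k : ℝ → ℝ) : Prop :=
  ContinuousOn k (Ioi 0) ∧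
  (α < m → k =O[𝓝[>] (0:ℝ)] fun r : ℝ => r ^ (α - m)) ∧
  (α = m → k =O[𝓝[>] (0:ℝ)] fun r : ℝ => Real.log r) ∧
  ((m : ℝ) < α → k =O[𝓝[>] (0:ℝ)] fun _ : ℝ => (1:ℝ))

/-- Condition `(C¹_α)`. -/
def CondC1 (m : ℕ) (α : ℝ) (k : ℝ → ℝ) : Prop :=
  ContDiffOn ℝ 1 k (Ioi 0) ∧
  (α < m → k =O[𝓝[>] (0:ℝ)] fun r : ℝ => r ^ (α - m)) ∧
  (α = m → k =O[𝓝[>] (0:ℝ)] fun r : ℝ => Real.log r) ∧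
  ((m : ℝ) < α → k =O[𝓝[>] (0:ℝ)] fun _ : ℝ => (1:ℝ)) ∧
  (α < m + 1 → deriv k =O[𝓝[>] (0:ℝ)] fun r : ℝ => r ^ (α - m - 1)) ∧
  (α = m + 1 → deriv k =O[𝓝[>] (0:ℝ)] fun r : ℝ => Real.log r) ∧
  ((m : ℝ) + 1 < α → deriv k =O[𝓝[>] (0:ℝ)] fun _ : ℝ => (1:ℝ))

/-- Reflection of `ℝ^m` in the hyperplane `{z : z ⬝ v = b}` (for a unit vector `v`). -/
def reflAt {m : ℕ} (v : Euc m) (b : ℝ) (z : Euc m) : Euc m :=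
  z + (2 * (b - ⟪z, v⟫)) • v

/-- `Ω⁺_{v,b}`, the part of `Ω` of height at least `b` in direction `v`. -/
def upSet {m : ℕ} (Ω : Set (Euc m)) (v : Euc m) (b : ℝ) : Set (Euc m) :=
  {z ∈ Ω | b ≤ ⟪z, v⟫}

/-- The minimum folding height `l(v)`. -/
def foldHeight {m : ℕ} (Ω : Set (Euc m)) (v : Euc m) : ℝ :=
  sInf {a : ℝ | ∀ b ≥ a, reflAt v b '' upSet Ω v b ⊆ Ω}

/-- The minimal unfolded region `Uf(Ω)`. -/
def unfolded {m : ℕ} (Ω : Set (Euc m)) : Set (Euc m) :=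
  ⋂ v ∈ sphere (0 : Euc m) 1, {z : Euc m | ⟪z, v⟫ ≤ foldHeight Ω v}

/-- `Ω` is convex in the direction `v`: every line parallel to `v` meets `Ω` in a connected set. -/
def ConvexInDir {m : ℕ} (Ω : Set (Euc m)) (v : Euc m) : Prop :=
  ∀ z : Euc m, ⟪z, v⟫ = 0 → IsPreconnected (Ω ∩ {w : Euc m | ∃ t : ℝ, w = z + t • v})

/-- `d(Ω) = min {|z - w| : z ∈ Uf(Ω), w ∈ ∂Ω}`. -/
def dMin {m : ℕ} (Ω : Set (Euc m)) : ℝ :=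
  sInf {d : ℝ | ∃ z ∈ unfolded Ω, ∃ w ∈ frontier Ω, d = dist z w}

/-- `D(Ω) = max {|z - w| : z ∈ Uf(Ω), w ∈ ∂Ω}`. -/
def dMax {m : ℕ} (Ω : Set (Euc m)) : ℝ :=
  sSup {d : ℝ | ∃ z ∈ unfolded Ω, ∃ w ∈ frontier Ω, d = dist z w}

/-- The `r^{α-m}`-potential `V^{(α)}_Ω`. -/
def rpot (m : ℕ) (α : ℝ) (Ω : Set (Euc m)) (x : Euc m) : ℝ :=
  if α = (m : ℝ) then -∫ y in Ω, Real.log (dist x y)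
  else Real.sign ((m : ℝ) - α) * ∫ y in Ω, dist x y ^ (α - (m : ℝ))

/-- The solid-angle (Poisson) potential `A_Ω(x, h)`. -/
def apot (m : ℕ) (Ω : Set (Euc m)) (x : Euc m) (h : ℝ) : ℝ :=
  ∫ y in Ω, h / (dist x y ^ 2 + h ^ 2) ^ (((m : ℝ) + 1) / 2)

lemma inner_reflAt {m : ℕ} {v : Euc m} (hv : ‖v‖ = 1) (b : ℝ) (z : Euc m) :
    ⟪reflAt v b z, v⟫ = 2 * b - ⟪z, v⟫ := by
  simp only [reflAt, inner_add_left, real_inner_smul_left, real_inner_self_eq_norm_sq, hv]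
  ring

lemma reflAt_reflAt {m : ℕ} {v : Euc m} (hv : ‖v‖ = 1) (b : ℝ) (z : Euc m) :
    reflAt v b (reflAt v b z) = z := by
  have h : reflAt v b (reflAt v b z) =
      reflAt v b z + (2 * (b - ⟪reflAt v b z, v⟫)) • v := rfl
  rw [h, inner_reflAt hv, reflAt]
  module

lemma continuous_reflAt {m : ℕ} (v : Euc m) (b : ℝ) : Continuous (reflAt v b) := by
  unfold reflAt
  fun_prop

lemma reflAt_zero_eq_reflection {m : ℕ} {v : Euc m} (hv : ‖v‖ = 1) :
    reflAt v 0 = (Submodule.span ℝ {v})ᗮ.reflection := by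
  funext z
  rw [Submodule.reflection_orthogonal_apply, Submodule.reflection_singleton_apply,
    real_inner_comm]
  simp only [reflAt, hv]
  simp only [RCLike.ofReal_real_eq_id, id_eq, one_pow, div_one]
  module

lemma reflAt_mem_of_foldHeight_lt {m : ℕ} {Ω : Set (Euc m)} (hΩ : Bornology.IsBounded Ω)
    {v : Euc m} (hv : ‖v‖ = 1) {b : ℝ} (hb : foldHeight Ω v < b) {z : Euc m} (hz : z ∈ Ω)
    (hbz : b ≤ ⟪z, v⟫) : reflAt v b z ∈ Ω := by
  have hne : {a : ℝ | ∀ b ≥ a, reflAt v b '' upSet Ω v b ⊆ Ω}.Nonempty := by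
    obtain ⟨C, hC⟩ := hΩ.exists_norm_le
    refine ⟨C + 1, fun b hb => ?_⟩
    rintro _ ⟨y, ⟨hy, hby⟩, rfl⟩
    have h1 := real_inner_le_norm y v
    have h2 := hC y hy
    rw [hv, mul_one] at h1
    linarith
  obtain ⟨a, ha, hab⟩ := exists_lt_of_csInf_lt hne hb
  exact ha b hab.le ⟨z, ⟨hz, hbz⟩, rfl⟩

lemma reflAt_mem_of_foldHeight_le {m : ℕ} {Ω : Set (Euc m)} (hΩ : IsCompact Ω)
    {v : Euc m} (hv : ‖v‖ = 1) {b : ℝ} (hb : foldHeight Ω v ≤ b) {z : Euc m} (hz : z ∈ Ω)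
    (hbz : b ≤ ⟪z, v⟫) : reflAt v b z ∈ Ω := by
  rcases hbz.eq_or_lt with h | h
  · simpa [reflAt, h] using hz
  · have hc : Continuous fun c : ℝ => reflAt v c z := by
      unfold reflAt
      fun_prop
    refine hΩ.isClosed.mem_of_tendsto
      ((hc.tendsto b).mono_left (nhdsWithin_le_nhds (s := Ioi b))) ?_
    filter_upwards [Ioo_mem_nhdsGT h] with c hc
    exact reflAt_mem_of_foldHeight_lt hΩ.isBounded hv (hb.trans_lt hc.1) hz hc.2.le

/-- Comparing the first moments of `Ω` and of its mirror image shows that they agree almost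
everywhere. -/
lemma ae_mem_iff_reflAt_mem {m : ℕ} {Ω : Set (Euc m)} (hΩ : IsCompact Ω)
    {v : Euc m} (hv : ‖v‖ = 1) (hfold : ∀ z ∈ Ω, 0 ≤ ⟪z, v⟫ → reflAt v 0 z ∈ Ω)
    (hcent : (∫ y in Ω, ⟪y, v⟫) = 0) :
    ∀ᵐ y : Euc m, y ∈ Ω ↔ reflAt v 0 y ∈ Ω := by
  set g : Euc m → ℝ := Ω.indicator fun y => ⟪y, v⟫ with hg
  have hgi : Integrable g := by
    rw [hg, integrable_indicator_iff hΩ.measurableSet]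
    exact ContinuousOn.integrableOn_compact hΩ (by fun_prop)
  have hg0 : ∫ y, g y = 0 := by
    rw [hg, integral_indicator hΩ.measurableSet, hcent]
  have hmp : MeasurePreserving (reflAt v 0 : Euc m → Euc m) := by
    rw [reflAt_zero_eq_reflection hv]
    exact LinearIsometryEquiv.measurePreserving _
  have hemb : MeasurableEmbedding (reflAt v 0 : Euc m → Euc m) := by
    rw [reflAt_zero_eq_reflection hv]
    exact (Submodule.span ℝ {v})ᗮ.reflection.toHomeomorph.measurableEmbedding
  have hgRi : Integrable fun y => g (reflAt v 0 y) := hmp.integrable_comp_of_integrable hgi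
  have hgR0 : ∫ y, g (reflAt v 0 y) = 0 := by rw [hmp.integral_comp hemb, hg0]
  have hneg : ∀ y ∈ Ω, reflAt v 0 y ∉ Ω → ⟪y, v⟫ < 0 :=
    fun y hy hy' => not_le.1 fun h => hy' (hfold y hy h)
  have hpos : ∀ y ∉ Ω, reflAt v 0 y ∈ Ω → ⟪reflAt v 0 y, v⟫ < 0 :=
    fun y hy hy' => hneg _ hy' (by rwa [reflAt_reflAt hv])
  have hnonneg : 0 ≤ fun y => -(g y + g (reflAt v 0 y)) := by
    intro y
    by_cases hy : y ∈ Ω <;> by_cases hy' : reflAt v 0 y ∈ Ω <;>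
      simp only [hg, Set.indicator, hy, hy', Pi.zero_apply, if_true, if_false]
    · rw [inner_reflAt hv]
      linarith
    · linarith [hneg y hy hy']
    · linarith [hpos y hy hy']
    · simp
  have hint : ∫ y, -(g y + g (reflAt v 0 y)) = 0 := by
    rw [integral_neg, integral_add hgi hgRi, hg0, hgR0]
    simp
  have hae := (integral_eq_zero_iff_of_nonneg hnonneg (hgi.add hgRi).neg).1 hint
  filter_upwards [hae] with y hy
  by_cases hyΩ : y ∈ Ω <;> by_cases hy' : reflAt v 0 y ∈ Ω <;>
    simp only [hg, Set.indicator, hyΩ, hy', Pi.zero_apply, if_true, if_false] at hy ⊢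
  · linarith [hneg y hyΩ hy']
  · linarith [hpos y hyΩ hy']

/-- A closed set containing almost every point of an open set contains its closure. -/
lemma IsOpen.closure_subset_of_ae_mem {X : Type*} [TopologicalSpace X] [MeasurableSpace X]
    {μ : Measure X} [μ.IsOpenPosMeasure] {U F : Set X} (hU : IsOpen U) (hF : IsClosed F)
    (h : ∀ᵐ y ∂μ, y ∈ U → y ∈ F) : closure U ⊆ F := by
  refine closure_minimal (fun y hy => ?_) hF
  by_contra hyF
  refine (hU.inter hF.isOpen_compl).measure_ne_zero μ ⟨y, hy, hyF⟩ ?_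
  refine measure_mono_null (fun x hx => ?_) (ae_iff.1 h)
  exact fun hx' => hx.2 (hx' hx.1)

lemma convexInDir_of_reflAt_mem {m : ℕ} {Ω : Set (Euc m)} {v : Euc m} (hv : ‖v‖ = 1)
    (hfold : ∀ b ≥ 0, ∀ z ∈ Ω, b ≤ ⟪z, v⟫ → reflAt v b z ∈ Ω)
    (hsymm : ∀ z ∈ Ω, reflAt v 0 z ∈ Ω) : ConvexInDir Ω v := by
  intro p hp
  have hin : ∀ t : ℝ, ⟪p + t • v, v⟫ = t := fun t => by
    simp [inner_add_left, real_inner_smul_left, hp, hv]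
  have hrefl : ∀ b t : ℝ, reflAt v b (p + t • v) = p + (2 * b - t) • v := fun b t => by
    rw [reflAt, hin]
    module
  have hnonneg : ∀ s t : ℝ, |s| ≤ t → p + t • v ∈ Ω → p + s • v ∈ Ω := by
    intro s t hst ht
    obtain ⟨h1, h2⟩ := abs_le.1 hst
    have h := hfold ((s + t) / 2) (by linarith) _ ht (by rw [hin]; linarith)
    rwa [hrefl, show 2 * ((s + t) / 2) - t = s by ring] at h
  have habs : ∀ s t : ℝ, |s| ≤ |t| → p + t • v ∈ Ω → p + s • v ∈ Ω := by
    intro s t hst ht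
    refine hnonneg s |t| hst ?_
    rcases abs_choice t with h | h <;> rw [h]
    · exact ht
    · have h' := hsymm _ ht
      rwa [hrefl, show 2 * 0 - t = -t by ring] at h'
  have hT : OrdConnected {t : ℝ | p + t • v ∈ Ω} := by
    refine ⟨fun t₁ h₁ t₂ h₂ s hs => ?_⟩
    rcases le_max_iff.1 (abs_le_max_abs_abs hs.1 hs.2) with h | h
    · exact habs s t₁ h h₁
    · exact habs s t₂ h h₂
  have himage : Ω ∩ {x : Euc m | ∃ t : ℝ, x = p + t • v} =
      (fun t : ℝ => p + t • v) '' {t : ℝ | p + t • v ∈ Ω} := by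
    ext x
    constructor
    · rintro ⟨hx, t, rfl⟩
      exact ⟨t, hx, rfl⟩
    · rintro ⟨t, ht, rfl⟩
      exact ⟨ht, t, rfl⟩
  rw [himage]
  exact hT.isPreconnected.image _ (by fun_prop)

/-- a direction with nonpositive folding height through the centroid gives a
hyperplane of symmetry and directional convexity. -/
theorem symmetry_of_foldHeight_nonpos {m : ℕ} (Ω : Set (Euc m)) (hΩ : IsBody Ω)
    (w : Euc m) (hw : w ∈ sphere (0 : Euc m) 1) (hl : foldHeight Ω w ≤ 0)
    (hcent : (∫ y in Ω, ⟪y, w⟫) = 0) :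
    Ω = upSet Ω w 0 ∪ reflAt w 0 '' upSet Ω w 0 ∧
    reflAt w 0 '' Ω = Ω ∧
    ConvexInDir Ω w := by
  have hv : ‖w‖ = 1 := by simpa using hw
  obtain ⟨U, hUo, -, hUb, rfl⟩ := hΩ
  have hK : IsCompact (closure U) := hUb.isCompact_closure
  have hfold : ∀ b ≥ 0, ∀ z ∈ closure U, b ≤ ⟪z, w⟫ → reflAt w b z ∈ closure U :=
    fun b hb z hz hbz => reflAt_mem_of_foldHeight_le hK hv (hl.trans hb) hz hbz
  have hsymm : ∀ z ∈ closure U, reflAt w 0 z ∈ closure U := by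
    refine hUo.closure_subset_of_ae_mem (μ := volume)
      (isClosed_closure.preimage (continuous_reflAt w 0)) ?_
    filter_upwards [ae_mem_iff_reflAt_mem hK hv (hfold 0 le_rfl) hcent] with y hy hyU
    exact hy.1 (subset_closure hyU)
  refine ⟨Subset.antisymm (fun z hz => ?_) (union_subset (fun z hz => hz.1) ?_),
    Subset.antisymm ?_ (fun z hz => ⟨_, hsymm z hz, reflAt_reflAt hv 0 z⟩),
    convexInDir_of_reflAt_mem hv hfold hsymm⟩
  · rcases le_total 0 ⟪z, w⟫ with h | h
    · exact Or.inl ⟨hz, h⟩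
    · refine Or.inr ⟨_, ⟨hsymm z hz, ?_⟩, reflAt_reflAt hv 0 z⟩
      rw [inner_reflAt hv]
      linarith
  · rintro _ ⟨z, hz, rfl⟩
    exact hsymm z hz.1
  · rintro _ ⟨z, hz, rfl⟩
    exact hsymm z hz
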